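/- Let f : ℝⁿ → ℝ be smooth with |∇f|² = 1 everywhere and Δf = b for a constant b ∈ ℝ, let a ∈ ℝ, let u : ℝⁿ → ℝ be smooth, and set g₁ = cos(af), g₂ = sin(af), p_i = (Δ²g_i)·u + 2∇(Δg_i)·∇u + 2(Δg_i)(Δu) + 2Δ(∇g_i·∇u) + 2∇g_i·∇(Δu) for i = 1, 2. Then pointwise on ℝⁿ: p₁² + p₂² = ( (a⁴ − a²b²)·u − 4a²b·(∇f·∇u) − 2a²·Δu − 4a²·∇f·∇(∇f·∇u) )² + ( 2a³b·u + 4a³·(∇f·∇u) − 2ab·Δu − 2a·Δ(∇f·∇u) − 2a·∇f·∇(Δu) )². -/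

import Mathlib

open MeasureTheory Real Filter
open scoped RealInnerProductSpace

/-- The partial derivative `∂f/∂x_m` on `ℝⁿ`. -/
noncomputable def pd {n : ℕ} (m : Fin n) (f : EuclideanSpace ℝ (Fin n) → ℝ)
    (x : EuclideanSpace ℝ (Fin n)) : ℝ :=
  fderiv ℝ f x (EuclideanSpace.single m 1)

/-- The Laplacian `Δf = ∑ ∂²f/∂x_m²` on `ℝⁿ`. -/
noncomputable def lap {n : ℕ} (f : EuclideanSpace ℝ (Fin n) → ℝ)
    (x : EuclideanSpace ℝ (Fin n)) : ℝ :=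
  ∑ m : Fin n, pd m (pd m f) x

/-- `p = (Δ²g)·u + 2∇(Δg)·∇u + 2(Δg)(Δu) + 2Δ(∇g·∇u) + 2∇g·∇(Δu)`. -/
noncomputable def pOf {n : ℕ} (g u : EuclideanSpace ℝ (Fin n) → ℝ)
    (x : EuclideanSpace ℝ (Fin n)) : ℝ :=
  lap (lap g) x * u x + 2 * ⟪gradient (lap g) x, gradient u x⟫
    + 2 * lap g x * lap u x
    + 2 * lap (fun y => ⟪gradient g y, gradient u y⟫) x
    + 2 * ⟪gradient g x, gradient (lap u) x⟫

theorem inner_gradient_eq_sum_pd {n : ℕ} (f u : EuclideanSpace ℝ (Fin n) → ℝ)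
    (x : EuclideanSpace ℝ (Fin n)) :
    ⟪gradient f x, gradient u x⟫ = ∑ m, pd m f x * pd m u x := by
  have key (g : EuclideanSpace ℝ (Fin n) → ℝ) (m : Fin n) : gradient g x m = pd m g x := by
    have h : ⟪gradient g x, EuclideanSpace.single m (1 : ℝ)⟫ = pd m g x := by
      simp [gradient, pd]
    rwa [EuclideanSpace.inner_single_right, one_mul] at h
  rw [PiLp.inner_apply]
  refine Finset.sum_congr rfl fun m _ => ?_
  rw [key, key]
  simp [mul_comm]

theorem contDiff_pd {n : ℕ} {f : EuclideanSpace ℝ (Fin n) → ℝ}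
    (hf : ContDiff ℝ (⊤ : ℕ∞) f) (m : Fin n) : ContDiff ℝ (⊤ : ℕ∞) (pd m f) :=
  (hf.fderiv_right (by simp)).clm_apply contDiff_const

theorem contDiff_inner_gradient {n : ℕ} {f u : EuclideanSpace ℝ (Fin n) → ℝ}
    (hf : ContDiff ℝ (⊤ : ℕ∞) f) (hu : ContDiff ℝ (⊤ : ℕ∞) u) :
    ContDiff ℝ (⊤ : ℕ∞) fun y => ⟪gradient f y, gradient u y⟫ := by
  simp only [inner_gradient_eq_sum_pd]
  exact ContDiff.sum fun m _ => (contDiff_pd hf m).mul (contDiff_pd hu m)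

theorem pd_comp {n : ℕ} {f : EuclideanSpace ℝ (Fin n) → ℝ} {h h' : ℝ → ℝ}
    (hh : ∀ t, HasDerivAt h (h' t) t) (hf : Differentiable ℝ f) (m : Fin n) :
    pd m (fun y => h (f y)) = fun y => h' (f y) * pd m f y := by
  funext y
  have := ((hh (f y)).comp_hasFDerivAt y (hf y).hasFDerivAt).fderiv
  simp only [pd]
  rw [show (fun y => h (f y)) = h ∘ f from rfl, this]
  simp

theorem pd_add {n : ℕ} {f g : EuclideanSpace ℝ (Fin n) → ℝ}
    (hf : Differentiable ℝ f) (hg : Differentiable ℝ g) (m : Fin n) :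
    pd m (fun y => f y + g y) = fun y => pd m f y + pd m g y := by
  funext y
  simp [pd, fderiv_fun_add (hf y) (hg y)]

theorem pd_mul {n : ℕ} {f g : EuclideanSpace ℝ (Fin n) → ℝ}
    (hf : Differentiable ℝ f) (hg : Differentiable ℝ g) (m : Fin n) :
    pd m (fun y => f y * g y) = fun y => pd m f y * g y + f y * pd m g y := by
  funext y
  simp [pd, fderiv_fun_mul (hf y) (hg y)]
  ring

theorem inner_gradient_comp {n : ℕ} {f : EuclideanSpace ℝ (Fin n) → ℝ} {h h' : ℝ → ℝ}
    (hh : ∀ t, HasDerivAt h (h' t) t) (hf : Differentiable ℝ f)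
    (u : EuclideanSpace ℝ (Fin n) → ℝ) (x : EuclideanSpace ℝ (Fin n)) :
    ⟪gradient (fun y => h (f y)) x, gradient u x⟫ =
      h' (f x) * ⟪gradient f x, gradient u x⟫ := by
  simp only [inner_gradient_eq_sum_pd, pd_comp hh hf, Finset.mul_sum, mul_assoc]

theorem lap_mul {n : ℕ} {f g : EuclideanSpace ℝ (Fin n) → ℝ}
    (hf : ContDiff ℝ (⊤ : ℕ∞) f) (hg : ContDiff ℝ (⊤ : ℕ∞) g)
    (x : EuclideanSpace ℝ (Fin n)) :
    lap (fun y => f y * g y) x =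
      lap f x * g x + 2 * ⟪gradient f x, gradient g x⟫ + f x * lap g x := by
  have df := hf.differentiable (by simp)
  have dg := hg.differentiable (by simp)
  have dpf m := (contDiff_pd hf m).differentiable (by simp)
  have dpg m := (contDiff_pd hg m).differentiable (by simp)
  simp only [inner_gradient_eq_sum_pd, lap, Finset.mul_sum, Finset.sum_mul,
    ← Finset.sum_add_distrib]
  refine Finset.sum_congr rfl fun m _ => ?_
  rw [pd_mul df dg, pd_add ((dpf m).fun_mul dg) (df.fun_mul (dpg m)), pd_mul (dpf m) dg,
    pd_mul df (dpg m)]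
  ring

theorem lap_comp {n : ℕ} {f : EuclideanSpace ℝ (Fin n) → ℝ} {h h' h'' : ℝ → ℝ}
    (hh : ∀ t, HasDerivAt h (h' t) t) (hh' : ∀ t, HasDerivAt h' (h'' t) t)
    (hf : ContDiff ℝ (⊤ : ℕ∞) f) (x : EuclideanSpace ℝ (Fin n)) :
    lap (fun y => h (f y)) x =
      h'' (f x) * ⟪gradient f x, gradient f x⟫ + h' (f x) * lap f x := by
  have df := hf.differentiable (by simp)
  have dh : Differentiable ℝ fun y => h' (f y) := fun y =>
    (hh' (f y)).differentiableAt.comp y (df y)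
  simp only [inner_gradient_eq_sum_pd, lap, Finset.mul_sum, ← Finset.sum_add_distrib]
  refine Finset.sum_congr rfl fun m _ => ?_
  rw [pd_comp hh df, pd_mul dh ((contDiff_pd hf m).differentiable (by simp)), pd_comp hh' df]
  ring

/-- `pOf` of `h ∘ f` when `h'' = -a² h`, `|∇f|² = 1` and `Δf = b`. -/
theorem pOf_comp_of_harmonic_oscillator {n : ℕ} {f u : EuclideanSpace ℝ (Fin n) → ℝ}
    (hf : ContDiff ℝ (⊤ : ℕ∞) f) (hu : ContDiff ℝ (⊤ : ℕ∞) u) {a b : ℝ}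
    (hgrad : ∀ x, ⟪gradient f x, gradient f x⟫ = 1) (hlap : ∀ x, lap f x = b)
    {h h' : ℝ → ℝ} (hh : ∀ t, HasDerivAt h (h' t) t)
    (hh' : ∀ t, HasDerivAt h' (-a ^ 2 * h t) t) (smooth : ContDiff ℝ (⊤ : ℕ∞) h')
    (x : EuclideanSpace ℝ (Fin n)) :
    pOf (fun y => h (f y)) u x =
      ((a ^ 4 - a ^ 2 * b ^ 2) * u x - 4 * a ^ 2 * b * ⟪gradient f x, gradient u x⟫
        - 2 * a ^ 2 * lap u x
        - 4 * a ^ 2 * ⟪gradient f x,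
            gradient (fun y => ⟪gradient f y, gradient u y⟫) x⟫) * h (f x)
      + (-2 * a ^ 2 * b * u x - 4 * a ^ 2 * ⟪gradient f x, gradient u x⟫
        + 2 * b * lap u x
        + 2 * lap (fun y => ⟪gradient f y, gradient u y⟫) x
        + 2 * ⟪gradient f x, gradient (lap u) x⟫) * h' (f x) := by
  have df := hf.differentiable (by simp)
  have hh'' t : HasDerivAt (fun t => -a ^ 2 * h t) (-a ^ 2 * h' t) t := (hh t).const_mul _
  have hL : lap (fun y => h (f y)) = fun y => (fun t => -a ^ 2 * h t + b * h' t) (f y) := by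
    funext y
    rw [lap_comp hh hh' hf, hgrad, hlap]
    ring
  have hH t : HasDerivAt (fun t => -a ^ 2 * h t + b * h' t)
      (-a ^ 2 * h' t + b * (-a ^ 2 * h t)) t := (hh'' t).add ((hh' t).const_mul b)
  have hH' t : HasDerivAt (fun t => -a ^ 2 * h' t + b * (-a ^ 2 * h t))
      (-a ^ 2 * (-a ^ 2 * h t) + b * (-a ^ 2 * h' t)) t :=
    ((hh' t).const_mul _).add ((hh'' t).const_mul b)
  unfold pOf
  simp only [inner_gradient_comp hh df]
  rw [hL, lap_comp hH hH' hf, inner_gradient_comp hH df,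
    lap_mul (f := fun y => h' (f y)) (smooth.comp hf) (contDiff_inner_gradient hf hu),
    lap_comp hh' hh'' hf,
    inner_gradient_comp hh' df, hgrad, hlap]
  ring

/-- Proposition 2.1: pointwise formula for `p₁² + p₂²` with `g₁ = cos(af)`, `g₂ = sin(af)`,
when `|∇f|² = 1` and `Δf = b`. -/
theorem clamped_plate_p1_sq_add_p2_sq {n : ℕ} (hn : 1 ≤ n)
    (f u : EuclideanSpace ℝ (Fin n) → ℝ)
    (hf : ContDiff ℝ (⊤ : ℕ∞) f) (hu : ContDiff ℝ (⊤ : ℕ∞) u)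
    (a b : ℝ)
    (hgrad : ∀ x, ⟪gradient f x, gradient f x⟫ = 1)
    (hlap : ∀ x, lap f x = b)
    (x : EuclideanSpace ℝ (Fin n)) :
    (pOf (fun y => Real.cos (a * f y)) u x) ^ 2
      + (pOf (fun y => Real.sin (a * f y)) u x) ^ 2 =
    ((a ^ 4 - a ^ 2 * b ^ 2) * u x - 4 * a ^ 2 * b * ⟪gradient f x, gradient u x⟫
        - 2 * a ^ 2 * lap u x
        - 4 * a ^ 2 * ⟪gradient f x,
            gradient (fun y => ⟪gradient f y, gradient u y⟫) x⟫) ^ 2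
      + (2 * a ^ 3 * b * u x + 4 * a ^ 3 * ⟪gradient f x, gradient u x⟫
        - 2 * a * b * lap u x
        - 2 * a * lap (fun y => ⟪gradient f y, gradient u y⟫) x
        - 2 * a * ⟪gradient f x, gradient (lap u) x⟫) ^ 2 := by
  have hlin t : HasDerivAt (fun t => a * t) a t := by
    simpa using (hasDerivAt_id t).const_mul a
  have hcos t : HasDerivAt (fun t => Real.cos (a * t)) (-a * Real.sin (a * t)) t :=
    ((hlin t).cos).congr_deriv (by ring)
  have hsin t : HasDerivAt (fun t => Real.sin (a * t)) (a * Real.cos (a * t)) t :=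
    ((hlin t).sin).congr_deriv (by ring)
  have hcos' t : HasDerivAt (fun t => -a * Real.sin (a * t)) (-a ^ 2 * Real.cos (a * t)) t :=
    ((hsin t).const_mul (-a)).congr_deriv (by ring)
  have hsin' t : HasDerivAt (fun t => a * Real.cos (a * t)) (-a ^ 2 * Real.sin (a * t)) t :=
    ((hcos t).const_mul a).congr_deriv (by ring)
  rw [pOf_comp_of_harmonic_oscillator hf hu hgrad hlap hcos hcos' (by fun_prop) x,
    pOf_comp_of_harmonic_oscillator hf hu hgrad hlap hsin hsin' (by fun_prop) x]
  generalize ⟪gradient f x, gradient (fun y => ⟪gradient f y, gradient u y⟫) x⟫ = q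
  generalize lap (fun y => ⟪gradient f y, gradient u y⟫) x = r
  have hcs := Real.sin_sq_add_cos_sq (a * f x)
  generalize Real.sin (a * f x) = s at *
  generalize Real.cos (a * f x) = c at *
  grind
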